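/- Define the parent map p : ℤ² → ℤ² by p(c) = (⌊c₁/2⌋, ⌊c₂/2⌋) using integer floor division, and the Chebyshev distance d_∞(c,d) = max(|c₁ − d₁|, |c₂ − d₂|). For every c ∈ ℤ², the set of near-neighbours of c, namely {d ∈ ℤ² : d_∞(p(d), p(c)) ≤ 1 and d_∞(d, c) ≥ 2}, has exactly 27 elements. (The key counting claim in the proof of Theorem 2: each cell has at most 27 near-neighbours, since among the 36 children of the parent's 3×3 parent block, the cell itself and its 8 immediate neighbours are excluded and all 9 of these lie in that block.) -/

import Mathlib

/-- The quadtree parent map on cells indexed by `ℤ²`: component-wise integer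
floor division by 2. -/
def parent (c : ℤ × ℤ) : ℤ × ℤ := (Int.fdiv c.1 2, Int.fdiv c.2 2)

/-- The Chebyshev (sup) distance on `ℤ²`. -/
def dInf (c d : ℤ × ℤ) : ℤ := max |c.1 - d.1| |c.2 - d.2|

/-- The cells whose parent is within distance 1 of the parent of `c` form a `6 × 6` block. -/
theorem dInf_parent_le_one_iff (c d : ℤ × ℤ) :
    dInf (parent d) (parent c) ≤ 1 ↔
      d ∈ Finset.Icc (2 * (c.1 / 2) - 2) (2 * (c.1 / 2) + 3) ×ˢ
        Finset.Icc (2 * (c.2 / 2) - 2) (2 * (c.2 / 2) + 3) := by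
  simp only [dInf, parent, Int.fdiv_eq_ediv_of_nonneg _ zero_le_two, max_le_iff, abs_le,
    Finset.mem_product, Finset.mem_Icc]
  omega

/-- The cells at distance at most 1 from `c` form a `3 × 3` block. -/
theorem two_le_dInf_iff (c d : ℤ × ℤ) :
    2 ≤ dInf d c ↔
      d ∉ Finset.Icc (c.1 - 1) (c.1 + 1) ×ˢ Finset.Icc (c.2 - 1) (c.2 + 1) := by
  simp only [dInf, le_max_iff, le_abs, Finset.mem_product, Finset.mem_Icc]
  omega

/-- Each cell has exactly 27 near-neighbours: cells that are not immediate
neighbours but whose parent is the parent of  or an immediate neighbour of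
the parent of . -/
theorem card_near_neighbours (c : ℤ × ℤ) :
    Set.ncard {d : ℤ × ℤ | dInf (parent d) (parent c) ≤ 1 ∧ 2 ≤ dInf d c} = 27 := by
  have hset : {d : ℤ × ℤ | dInf (parent d) (parent c) ≤ 1 ∧ 2 ≤ dInf d c} =
      ↑((Finset.Icc (2 * (c.1 / 2) - 2) (2 * (c.1 / 2) + 3) ×ˢ
          Finset.Icc (2 * (c.2 / 2) - 2) (2 * (c.2 / 2) + 3)) \
        (Finset.Icc (c.1 - 1) (c.1 + 1) ×ˢ Finset.Icc (c.2 - 1) (c.2 + 1))) := by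
    ext d
    rw [Set.mem_ofPred_eq, dInf_parent_le_one_iff, two_le_dInf_iff, Finset.mem_coe,
      Finset.mem_sdiff]
  have hsub : Finset.Icc (c.1 - 1) (c.1 + 1) ×ˢ Finset.Icc (c.2 - 1) (c.2 + 1) ⊆
      Finset.Icc (2 * (c.1 / 2) - 2) (2 * (c.1 / 2) + 3) ×ˢ
        Finset.Icc (2 * (c.2 / 2) - 2) (2 * (c.2 / 2) + 3) :=
    Finset.product_subset_product (Finset.Icc_subset_Icc (by omega) (by omega))
      (Finset.Icc_subset_Icc (by omega) (by omega))
  have hblock (a : ℤ) : 2 * (a / 2) + 3 + 1 - (2 * (a / 2) - 2) = 6 := by ring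
  have hnear (a : ℤ) : a + 1 + 1 - (a - 1) = 3 := by ring
  rw [hset, Set.ncard_coe_finset, Finset.card_sdiff_of_subset hsub]
  simp only [Finset.card_product, Int.card_Icc, hblock, hnear]
  rfl
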